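/- Let (a_k)_{k ≥ 0} be real numbers with a_k ≥ 0 for all k, ∑_k a_k = 1 and a_0 > 0, and let A be the repair-shop transition matrix on ℕ: A 0 j = a_j for all j, and for i ≥ 1, A i j = a_{j−i+1} if j ≥ i−1 and A i j = 0 otherwise. Let m = ∑_k k·a_k ∈ [0,∞] (the mean of the step distribution, computed in the extended reals). Then the series ∑_{N ≥ 0} det(Id − A_{[0,N]}) / a_0^{N+1} (whose terms are nonnegative) converges if and only if m < 1, and in that case its sum equals m/(1−m). (By the invariant-measure formula for almost upper triangular transition matrices, this is the criterion for positive recurrence of the repair-shop chain X_{n+1} = (X_n − 1)_+ + Z_{n+1} with i.i.d. steps Z of law (a_k).) -/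

import Mathlib

open scoped ENNReal

/-- `detOneSubI M a b = det(Id − M_{[a,b]})`, equal to `1` when `a > b`. -/
noncomputable def detOneSubI (M : ℕ → ℕ → ℝ) (a b : ℕ) : ℝ :=
  Matrix.det (1 - Matrix.of fun i j : Fin (b + 1 - a) => M (a + i.1) (a + j.1))

/-- The repair-shop transition matrix associated with the step distribution `a`:
row `0` is `(a_0, a_1, …)` and, for `i ≥ 1`, `A i j = a_{j−i+1}` if `j ≥ i − 1`
and `0` otherwise. -/
noncomputable def repairShop (a : ℕ → ℝ) : ℕ → ℕ → ℝ :=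
  fun i j => if i = 0 then a j else if i ≤ j + 1 then a (j + 1 - i) else 0

open Finset

/-- The tail `∑_{k > n} a_k` of a sequence with sum `1`. -/
noncomputable def tailSum (a : ℕ → ℝ) (n : ℕ) : ℝ := 1 - ∑ k ∈ range (n + 1), a k

/-- The solution `q` of the renewal equation `q = t + q * t` with `t = tailSum a`. The invariant
measure of the repair-shop matrix with mass `1` at `0` has mass `q n` at `n + 1`. -/
noncomputable def renewalSolution (a : ℕ → ℝ) (n : ℕ) : ℝ :=
  (tailSum a n + ∑ i : Fin n, renewalSolution a i * tailSum a (n - i)) / a 0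

theorem tailSum_zero (a : ℕ → ℝ) : tailSum a 0 = 1 - a 0 := by simp [tailSum]

theorem tailSum_succ (a : ℕ → ℝ) (n : ℕ) : tailSum a (n + 1) = tailSum a n - a (n + 1) := by
  rw [tailSum, sum_range_succ, tailSum]; ring

theorem hasSum_tailSum {a : ℕ → ℝ} (hsum : HasSum a 1) (n : ℕ) :
    HasSum (fun k => a (k + (n + 1))) (tailSum a n) :=
  (hasSum_nat_add_iff' (n + 1)).2 hsum

theorem tailSum_nonneg {a : ℕ → ℝ} (hnn : ∀ k, 0 ≤ a k) (hsum : HasSum a 1) (n : ℕ) :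
    0 ≤ tailSum a n :=
  (hasSum_tailSum hsum n).nonneg fun _ => hnn _

theorem tsum_ofReal_tailSum {a : ℕ → ℝ} (hnn : ∀ k, 0 ≤ a k) (hsum : HasSum a 1) :
    ∑' n, ENNReal.ofReal (tailSum a n) = ∑' k : ℕ, (k : ℝ≥0∞) * ENNReal.ofReal (a k) := by
  have htail (n : ℕ) : ENNReal.ofReal (tailSum a n) =
      ∑' k, if n < k then ENNReal.ofReal (a k) else 0 := by
    rw [← (hasSum_tailSum hsum n).tsum_eq,
      ENNReal.ofReal_tsum_of_nonneg (fun _ => hnn _) (hasSum_tailSum hsum n).summable,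
      ← ENNReal.summable.sum_add_tsum_nat_add' (k := n + 1) (f := fun k => if n < k then _ else _),
      sum_eq_zero, zero_add]
    · exact tsum_congr fun k => (if_pos (by omega)).symm
    · intro k hk
      exact if_neg (by have := mem_range.1 hk; omega)
  simp_rw [htail]
  rw [ENNReal.tsum_comm]
  refine tsum_congr fun k => ?_
  rw [tsum_eq_sum (s := range k) fun n hn => if_neg (by simpa using hn),
    sum_congr rfl fun n hn => if_pos (mem_range.1 hn)]
  simp

theorem renewalSolution_eq {a : ℕ → ℝ} (ha0 : a 0 ≠ 0) (n : ℕ) :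
    renewalSolution a n =
      tailSum a n + ∑ i ∈ range (n + 1), renewalSolution a i * tailSum a (n - i) := by
  have h : a 0 * renewalSolution a n =
      tailSum a n + ∑ i ∈ range n, renewalSolution a i * tailSum a (n - i) := by
    rw [renewalSolution, mul_div_cancel₀ _ ha0,
      Fin.sum_univ_eq_sum_range (fun i => renewalSolution a i * tailSum a (n - i))]
  rw [sum_range_succ, Nat.sub_self, tailSum_zero]
  linear_combination h

theorem renewalSolution_nonneg {a : ℕ → ℝ} (hnn : ∀ k, 0 ≤ a k) (hsum : HasSum a 1) (n : ℕ) :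
    0 ≤ renewalSolution a n := by
  induction n using Nat.strong_induction_on with
  | _ n ih =>
    rw [renewalSolution]
    exact div_nonneg (add_nonneg (tailSum_nonneg hnn hsum n) (sum_nonneg fun i _ =>
      mul_nonneg (ih i i.2) (tailSum_nonneg hnn hsum _))) (hnn 0)

theorem renewalSolution_invariant_zero {a : ℕ → ℝ} (ha0 : a 0 ≠ 0) :
    1 = a 0 + renewalSolution a 0 * a 0 := by
  have h := renewalSolution_eq ha0 0
  simp only [zero_add, sum_range_one, Nat.sub_self, tailSum_zero] at h
  linear_combination -h

theorem renewalSolution_invariant_succ {a : ℕ → ℝ} (ha0 : a 0 ≠ 0) (n : ℕ) :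
    renewalSolution a n =
      a (n + 1) + ∑ i ∈ range (n + 2), renewalSolution a i * a (n + 1 - i) := by
  have h₀ := renewalSolution_eq ha0 n
  have h₁ := renewalSolution_eq ha0 (n + 1)
  have hdiff : ∑ i ∈ range (n + 1), renewalSolution a i * tailSum a (n + 1 - i) =
      ∑ i ∈ range (n + 1), renewalSolution a i * tailSum a (n - i) -
        ∑ i ∈ range (n + 1), renewalSolution a i * a (n + 1 - i) := by
    rw [← sum_sub_distrib]
    refine sum_congr rfl fun i hi => ?_
    rw [Nat.sub_add_comm (Nat.lt_succ_iff.1 (mem_range.1 hi)), tailSum_succ]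
    ring
  rw [sum_range_succ, hdiff, Nat.sub_self, tailSum_zero, tailSum_succ] at h₁
  rw [sum_range_succ, Nat.sub_self]
  linear_combination h₀ - h₁

/-- If a combination of the rows of a matrix, with coefficient `1` on the first row, is supported
in the last column, and the matrix without its first row and last column is upper triangular,
then the determinant is a product. -/
theorem Matrix.det_eq_of_row_combination {R : Type*} [CommRing R] {n : ℕ}
    (B : Matrix (Fin (n + 1)) (Fin (n + 1)) R) (c : Fin (n + 1) → R) (x : R) (hc : c 0 = 1)
    (hrow : ∑ i, c i • B i = Pi.single (Fin.last n) x)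
    (htri : ∀ i j : Fin n, j < i → B i.succ j.castSucc = 0) :
    B.det = (-1) ^ n * x * ∏ i : Fin n, B i.succ i.castSucc := by
  have h := Matrix.det_updateRow_sum B 0 c
  rw [hc, one_smul, hrow] at h
  rw [← h, Matrix.det_succ_row_zero, sum_eq_single (Fin.last n)]
  · have hsub : (B.updateRow 0 (Pi.single (Fin.last n) x)).submatrix Fin.succ
        (Fin.last n).succAbove = Matrix.of fun i j : Fin n => B i.succ j.castSucc := by
      ext i j
      simp
    rw [hsub, Matrix.det_of_isUpperTriangular (M := Matrix.of fun i j : Fin n => B i.succ j.castSucc)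
      fun i j hij => htri i j hij]
    simp
  · intro j _ hj
    simp [Pi.single_eq_of_ne hj]
  · simp

theorem detOneSubI_repairShop {a : ℕ → ℝ} (ha0 : a 0 ≠ 0) (n : ℕ) :
    detOneSubI (repairShop a) 0 n = renewalSolution a n * a 0 ^ (n + 1) := by
  let B : Matrix (Fin (n + 1)) (Fin (n + 1)) ℝ :=
    1 - Matrix.of fun i j : Fin (n + 1) => repairShop a i j
  have hB : detOneSubI (repairShop a) 0 n = B.det := by
    simp only [detOneSubI, zero_add]
    rfl
  have hsucc (i : Fin n) (j : Fin (n + 1)) : B i.succ j =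
      (if (j : ℕ) = i + 1 then 1 else 0) - if (i : ℕ) ≤ j then a (j - i) else 0 := by
    simp only [B, Matrix.sub_apply, Matrix.one_apply, Matrix.of_apply, repairShop, Fin.ext_iff]
    simp [eq_comm]
  have hzero (j : Fin (n + 1)) : B 0 j = (if (j : ℕ) = 0 then 1 else 0) - a j := by
    simp only [B, Matrix.sub_apply, Matrix.one_apply, Matrix.of_apply, repairShop, Fin.ext_iff]
    simp [eq_comm]
  rw [hB, Matrix.det_eq_of_row_combination B (Fin.cons 1 fun i => renewalSolution a i)
    (renewalSolution a n * a 0) rfl]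
  · have hdiag (i : Fin n) : B i.succ i.castSucc = -a 0 := by simp [hsucc]
    simp only [hdiag, prod_const, card_univ, Fintype.card_fin]
    rw [neg_pow (a 0), pow_succ (a 0)]
    have : ((-1 : ℝ) ^ n) * (-1) ^ n = 1 := by rw [← mul_pow]; simp
    linear_combination renewalSolution a n * a 0 * a 0 ^ n * this
  · ext j
    have hcol : ∑ i : Fin n, renewalSolution a i * B i.succ j =
        ∑ i ∈ range n, renewalSolution a i *
          ((if (j : ℕ) = i + 1 then 1 else 0) - if i ≤ (j : ℕ) then a (j - i) else 0) := by
      rw [← Fin.sum_univ_eq_sum_range fun i => renewalSolution a i *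
          ((if (j : ℕ) = i + 1 then 1 else 0) - if i ≤ (j : ℕ) then a (j - i) else 0)]
      simp [hsucc]
    rw [Fin.sum_univ_succ]
    simp only [Fin.cons_zero, Fin.cons_succ, Pi.add_apply, Finset.sum_apply, Pi.smul_apply,
      smul_eq_mul, one_mul]
    rw [hcol, hzero]
    obtain ⟨j, hj⟩ := j
    simp only [mul_sub, sum_sub_distrib]
    have hfilter : ∑ i ∈ range n, renewalSolution a i * (if i ≤ j then a (j - i) else 0) =
        ∑ i ∈ range (j + 1), renewalSolution a i * a (j - i) -
          if j = n then renewalSolution a n * a 0 else 0 := by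
      split_ifs with hjn
      · subst hjn
        rw [sum_range_succ, Nat.sub_self, add_sub_cancel_right]
        exact sum_congr rfl fun i hi => by rw [if_pos (mem_range.1 hi).le]
      · rw [sub_zero]
        symm
        refine sum_subset_zero_on_sdiff (range_subset_range.2 (by omega)) ?_ ?_
        · intro i hi
          have : ¬ i ≤ j := by simp at hi; omega
          simp [this]
        · intro i hi
          rw [if_pos (by simpa [Nat.lt_succ_iff] using hi)]
    have hsingle : (Pi.single (Fin.last n) (renewalSolution a n * a 0) : Fin (n + 1) → ℝ) ⟨j, hj⟩ =
        if j = n then renewalSolution a n * a 0 else 0 := by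
      simp [Pi.single_apply, Fin.ext_iff]
    rw [hfilter, hsingle]
    cases j with
    | zero =>
      have := renewalSolution_invariant_zero ha0
      simp
      linear_combination this
    | succ j =>
      have hdelta : ∑ i ∈ range n, renewalSolution a i * (if j + 1 = i + 1 then (1 : ℝ) else 0) =
          renewalSolution a j := by
        rw [sum_eq_single j]
        · simp
        · intro i _ hij
          simp [hij.symm]
        · intro h
          exact absurd (mem_range.2 (by omega)) h
      have := renewalSolution_invariant_succ ha0 j
      rw [hdelta, if_neg (Nat.succ_ne_zero j)]
      linear_combination this
  · intro i j hij
    have h₁ : ¬ (i : ℕ) ≤ j := not_le.2 hij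
    have h₂ : ¬ (j : ℕ) = i + 1 := by omega
    simp [hsucc, h₁, h₂]

section Renewal

variable {q t : ℕ → ℝ}

/-- A nonnegative solution of the renewal equation `q = t + q * t` with `∑ t < 1` is summable. -/
theorem summable_of_renewal (hq : ∀ n, 0 ≤ q n) (ht : ∀ n, 0 ≤ t n)
    (h : ∀ n, q n = t n + ∑ i ∈ range (n + 1), q i * t (n - i)) (hts : Summable t)
    (ht1 : ∑' n, t n < 1) : Summable q := by
  refine summable_of_sum_range_le (c := (∑' n, t n) / (1 - ∑' n, t n)) hq fun n => ?_
  rw [le_div_iff₀ (sub_pos.2 ht1)]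
  have hpartial (k : ℕ) : ∑ i ∈ range k, t i ≤ ∑' n, t n := hts.sum_le_tsum _ fun i _ => ht i
  have hconv : ∑ k ∈ range n, ∑ i ∈ range (k + 1), q i * t (k - i) ≤
      (∑ i ∈ range n, q i) * ∑' n, t n := by
    rw [sum_range_diag_flip n fun i j => q i * t j, sum_mul]
    refine sum_le_sum fun i _ => ?_
    rw [← mul_sum]
    exact mul_le_mul_of_nonneg_left (hpartial _) (hq i)
  have hsplit : ∑ k ∈ range n, q k = ∑ k ∈ range n, t k +
      ∑ k ∈ range n, ∑ i ∈ range (k + 1), q i * t (k - i) := by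
    rw [← sum_add_distrib]
    exact sum_congr rfl fun k _ => h k
  linarith [hpartial n]

theorem summable_left_of_renewal (hq : ∀ n, 0 ≤ q n) (ht : ∀ n, 0 ≤ t n)
    (h : ∀ n, q n = t n + ∑ i ∈ range (n + 1), q i * t (n - i)) (hqs : Summable q) :
    Summable t :=
  hqs.of_nonneg_of_le ht fun n => by
    rw [h n]
    exact le_add_of_nonneg_right (sum_nonneg fun i _ => mul_nonneg (hq i) (ht _))

theorem tsum_eq_of_renewal (hq : ∀ n, 0 ≤ q n) (ht : ∀ n, 0 ≤ t n)
    (h : ∀ n, q n = t n + ∑ i ∈ range (n + 1), q i * t (n - i)) (hqs : Summable q) :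
    ∑' n, q n = ∑' n, t n + (∑' n, q n) * ∑' n, t n := by
  have hts := summable_left_of_renewal hq ht h hqs
  rw [tsum_mul_tsum_eq_tsum_sum_range_of_summable_norm hqs.norm hts.norm,
    ← hts.tsum_add (summable_norm_sum_mul_range_of_summable_norm hqs.norm hts.norm).of_norm]
  exact tsum_congr h

end Renewal

/-- Positive recurrence criterion for the repair-shop chain: the (nonnegative-term)
series `∑_N det(Id − A_{[0,N]}) / a_0^{N+1}` converges iff the mean `m = ∑_k k·a_k`
(in the extended reals) is `< 1`, in which case its sum is `m / (1 − m)`. -/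
theorem repairShop_positive_recurrence_criterion (a : ℕ → ℝ)
    (hnn : ∀ k, 0 ≤ a k) (hsum : HasSum a 1) (ha0 : 0 < a 0)
    (m : ℝ≥0∞) (hm : m = ∑' k : ℕ, (k : ℝ≥0∞) * ENNReal.ofReal (a k)) :
    (Summable (fun N : ℕ => detOneSubI (repairShop a) 0 N / a 0 ^ (N + 1)) ↔ m < 1) ∧
    (m < 1 →
      ∑' N : ℕ, detOneSubI (repairShop a) 0 N / a 0 ^ (N + 1) =
        m.toReal / (1 - m.toReal)) := by
  set t := tailSum a
  set q := renewalSolution a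
  have hterm (N : ℕ) : detOneSubI (repairShop a) 0 N / a 0 ^ (N + 1) = q N := by
    rw [detOneSubI_repairShop ha0.ne', mul_div_cancel_right₀ _ (pow_ne_zero _ ha0.ne')]
  simp_rw [hterm]
  have hq : ∀ n, 0 ≤ q n := renewalSolution_nonneg hnn hsum
  have ht : ∀ n, 0 ≤ t n := tailSum_nonneg hnn hsum
  have hrenewal : ∀ n, q n = t n + ∑ i ∈ range (n + 1), q i * t (n - i) :=
    renewalSolution_eq ha0.ne'
  have hmt : m = ∑' n, ENNReal.ofReal (t n) := by rw [hm, tsum_ofReal_tailSum hnn hsum]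
  have hm_eq (hts : Summable t) : m = ENNReal.ofReal (∑' n, t n) := by
    rw [hmt, ENNReal.ofReal_tsum_of_nonneg ht hts]
  have hts_of_lt (hm1 : m < 1) : Summable t := by
    have := ENNReal.summable_toReal (hmt ▸ hm1.ne_top)
    simpa only [ENNReal.toReal_ofReal (ht _)] using this
  have hqs_of_lt (hm1 : m < 1) : Summable q := by
    have hts := hts_of_lt hm1
    refine summable_of_renewal hq ht hrenewal hts ?_
    rwa [hm_eq hts, ENNReal.ofReal_lt_one] at hm1
  refine ⟨⟨fun hqs => ?_, hqs_of_lt⟩, fun hm1 => ?_⟩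
  · rw [hm_eq (summable_left_of_renewal hq ht hrenewal hqs), ENNReal.ofReal_lt_one]
    have hsolve := tsum_eq_of_renewal hq ht hrenewal hqs
    have hnonneg : 0 ≤ ∑' n, q n := tsum_nonneg hq
    by_contra! hge
    nlinarith
  · have hsolve := tsum_eq_of_renewal hq ht hrenewal (hqs_of_lt hm1)
    have hts := hts_of_lt hm1
    rw [hm_eq hts, ENNReal.ofReal_lt_one] at hm1
    rw [hm_eq hts, ENNReal.toReal_ofReal (tsum_nonneg ht), eq_div_iff (sub_pos.2 hm1).ne']
    linear_combination hsolve
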